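/- arXiv:2311.11907 — 2 statements merged into one kernel-verified Lean document; each statement's English description precedes it below -/
import Mathlib

section
/- The real vector space of derivations of the octonions, i.e. of ℝ-linear maps D : 𝕆 → 𝕆 satisfying D(x·y) = D(x)·y + x·D(y) for all x,y ∈ 𝕆, has dimension 14 (it is the compact Lie algebra 𝔤₂). -/
/- Octonions via the Cayley–Dickson construction over the quaternions. -/

noncomputable section

open Quaternion

/-- The octonions, as pairs of quaternions. -/
abbrev Oct : Type := ℍ[ℝ] × ℍ[ℝ]

/-- Cayley–Dickson multiplication: (a,b)·(c,d) = (a·c − conj(d)·b, d·a + b·conj(c)). -/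
def omul (x y : Oct) : Oct :=
  ⟨x.1 * y.1 - star y.2 * x.2, y.2 * x.1 + x.2 * star y.1⟩

/-- Octonionic conjugation: conj(a,b) = (conj a, −b). -/
def oconj (x : Oct) : Oct := ⟨star x.1, -x.2⟩

/-- The octonionic unit. -/
def oone : Oct := ⟨1, 0⟩

/-- The octonionic norm: the sum of the squares of the eight real coordinates. -/
def onorm (x : Oct) : ℝ := Quaternion.normSq x.1 + Quaternion.normSq x.2

lemma omul_add_left (x x' y : Oct) : omul (x + x') y = omul x y + omul x' y := by
  simp only [omul, Prod.fst_add, Prod.snd_add, Prod.mk_add_mk, Prod.mk.injEq, add_mul, mul_add]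
  constructor <;> abel

lemma omul_add_right (x y y' : Oct) : omul x (y + y') = omul x y + omul x y' := by
  simp only [omul, Prod.fst_add, Prod.snd_add, Prod.mk_add_mk, Prod.mk.injEq, add_mul, mul_add,
    star_add]
  constructor <;> abel

lemma omul_smul_left (r : ℝ) (x y : Oct) : omul (r • x) y = r • omul x y := by
  simp [omul, Prod.ext_iff, smul_mul_assoc, mul_smul_comm, smul_sub, smul_add]

lemma omul_smul_right (r : ℝ) (x y : Oct) : omul x (r • y) = r • omul x y := by
  simp [omul, Prod.ext_iff, smul_mul_assoc, mul_smul_comm, smul_sub, smul_add, Quaternion.star_smul]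

lemma omul_zero_left (y : Oct) : omul 0 y = 0 := by
  simp [omul, Prod.ext_iff]

lemma omul_zero_right (x : Oct) : omul x 0 = 0 := by
  simp [omul, Prod.ext_iff]

/-- The space of derivations of the octonions. -/
def octDer : Submodule ℝ (Oct →ₗ[ℝ] Oct) where
  carrier := {D | ∀ x y : Oct, D (omul x y) = omul (D x) y + omul x (D y)}
  zero_mem' := by
    intro x y
    simp [omul_zero_left, omul_zero_right]
  add_mem' := by
    intro f g hf hg x y
    simp only [LinearMap.add_apply, hf x y, hg x y, omul_add_left, omul_add_right]
    abel
  smul_mem' := by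
    intro c f hf x y
    simp only [LinearMap.smul_apply, hf x y, omul_smul_left, omul_smul_right, smul_add]

/-- The quaternion with given coordinates. -/
def quat (a b c d : ℝ) : ℍ[ℝ] := ⟨a, b, c, d⟩

section

variable (a b c d : ℝ)

@[simp] lemma quat_re : (quat a b c d).re = a := rfl

@[simp] lemma quat_imI : (quat a b c d).imI = b := rfl

@[simp] lemma quat_imJ : (quat a b c d).imJ = c := rfl

@[simp] lemma quat_imK : (quat a b c d).imK = d := rfl

end

/-- The first quaternion unit `i`, as an octonion. -/
def octI : Oct := (quat 0 1 0 0, 0)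

/-- The second quaternion unit `j`, as an octonion. -/
def octJ : Oct := (quat 0 0 1 0, 0)

/-- The Cayley–Dickson unit `ℓ`. -/
def octL : Oct := (0, 1)

lemma omul_oone_oone : omul oone oone = oone := by
  simp [omul, oone]

lemma omul_octI_octI : omul octI octI = -oone := by
  simp only [omul, octI, oone]; ext <;> simp

lemma omul_octJ_octJ : omul octJ octJ = -oone := by
  simp only [omul, octJ, oone]; ext <;> simp

lemma omul_octJ_octI : omul octJ octI = -omul octI octJ := by
  simp only [omul, octI, octJ]; ext <;> simp

lemma omul_octL_octL : omul octL octL = -oone := by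
  simp only [omul, octL, oone]; ext <;> simp

lemma omul_octL_octI : omul octL octI = -omul octI octL := by
  simp only [omul, octI, octL]; ext <;> simp

lemma omul_octL_octJ : omul octL octJ = -omul octJ octL := by
  simp only [omul, octJ, octL]; ext <;> simp

lemma omul_octL_octK : omul octL (omul octI octJ) = -omul (omul octI octJ) octL := by
  simp only [omul, octI, octJ, octL]; ext <;> simp

/-- Every quaternion is a combination of `1`, `i`, `j` and `ij`. -/
lemma mk_zero_eq (a : ℍ[ℝ]) :
    ((a, 0) : Oct) = a.re • oone + a.imI • octI + a.imJ • octJ + a.imK • omul octI octJ := by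
  simp only [omul, octI, octJ, oone]; ext <;> simp

/-- Every octonion is `a + bℓ` with `a`, `b` quaternions. -/
lemma mk_eq_add_omul_octL (a b : ℍ[ℝ]) : ((a, b) : Oct) = (a, 0) + omul (b, 0) octL := by
  simp [omul, octL]

namespace octDer

lemma map_omul {D : Oct →ₗ[ℝ] Oct} (hD : D ∈ octDer) (x y : Oct) :
    D (omul x y) = omul (D x) y + omul x (D y) := hD x y

lemma map_omul_eq_zero {D : Oct →ₗ[ℝ] Oct} (hD : D ∈ octDer) {x y : Oct}
    (hx : D x = 0) (hy : D y = 0) : D (omul x y) = 0 := by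
  rw [map_omul hD, hx, hy, omul_zero_left, omul_zero_right, add_zero]

lemma map_oone {D : Oct →ₗ[ℝ] Oct} (hD : D ∈ octDer) : D oone = 0 := by
  have h := map_omul hD oone oone
  rw [omul_oone_oone] at h
  simpa [omul, oone] using h

/-- A derivation sends an element squaring to `-1` to one anticommuting with it. -/
lemma map_of_omul_self {D : Oct →ₗ[ℝ] Oct} (hD : D ∈ octDer) {x : Oct}
    (hx : omul x x = -oone) : omul (D x) x + omul x (D x) = 0 := by
  rw [← map_omul hD, hx, map_neg, map_oone hD, neg_zero]

lemma map_of_anticomm {D : Oct →ₗ[ℝ] Oct} (hD : D ∈ octDer) {x y : Oct}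
    (hxy : omul y x = -omul x y) :
    omul (D y) x + omul y (D x) + (omul (D x) y + omul x (D y)) = 0 := by
  rw [← map_omul hD, ← map_omul hD, hxy, map_neg, neg_add_cancel]

/-- The octonions are generated by `i`, `j` and `ℓ`. -/
lemma eq_zero_of_generators {D : Oct →ₗ[ℝ] Oct} (hD : D ∈ octDer)
    (hI : D octI = 0) (hJ : D octJ = 0) (hL : D octL = 0) : D = 0 := by
  have hH (a : ℍ[ℝ]) : D (a, 0) = 0 := by
    rw [mk_zero_eq]
    simp [map_oone hD, hI, hJ, map_omul_eq_zero hD hI hJ]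
  refine LinearMap.ext fun x => ?_
  obtain ⟨a, b⟩ := x
  rw [mk_eq_add_omul_octL, map_add, hH, map_omul_eq_zero hD (hH b) hL, add_zero,
    LinearMap.zero_apply]

/-- The space of coordinates of a derivation. -/
abbrev Coord : Type := (ℍ[ℝ] × ℍ[ℝ]) × ((Fin 3 → ℝ) × (Fin 3 → ℝ))

lemma finrank_coord : Module.finrank ℝ Coord = 14 := by
  simp [Module.finrank_prod, Quaternion.finrank_eq_four]

/-- The coordinates of a linear map which determine it among derivations. -/
def coords : (Oct →ₗ[ℝ] Oct) →ₗ[ℝ] Coord where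
  toFun D := (((D octI).2, (D octJ).2),
    (![(D octI).1.imJ, (D octI).1.imK, (D octJ).1.imK],
      ![(D octL).2.imI, (D octL).2.imJ, (D octL).2.imK]))
  map_add' D E := by simp
  map_smul' r D := by simp

lemma coords_apply (D : Oct →ₗ[ℝ] Oct) : coords D = (((D octI).2, (D octJ).2),
    (![(D octI).1.imJ, (D octI).1.imK, (D octJ).1.imK],
      ![(D octL).2.imI, (D octL).2.imJ, (D octL).2.imK])) := rfl

lemma eq_zero_of_coords_eq_zero {D : Oct →ₗ[ℝ] Oct} (hD : D ∈ octDer) (h : coords D = 0) :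
    D = 0 := by
  rw [coords_apply] at h
  simp only [Prod.mk_eq_zero, Matrix.cons_eq_zero_iff] at h
  obtain ⟨⟨hu, hv⟩, ⟨h1, h2, h3, -⟩, h4, h5, h6, -⟩ := h
  have hII := map_of_omul_self hD omul_octI_octI
  have hJJ := map_of_omul_self hD omul_octJ_octJ
  have hIJ := map_of_anticomm hD omul_octJ_octI
  have hI : D octI = 0 := by
    generalize D octI = x at *
    generalize D octJ = y at *
    obtain ⟨a, b⟩ := x
    simp only [octI, omul, Prod.ext_iff, Quaternion.ext_iff] at *
    simp at *
    refine ⟨⟨?_, ?_, ?_, ?_⟩, ?_⟩ <;> first | assumption | linarith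
  have hJ : D octJ = 0 := by
    rw [hI] at hIJ
    generalize D octJ = y at *
    obtain ⟨a, b⟩ := y
    simp only [octI, octJ, omul, Prod.ext_iff, Quaternion.ext_iff] at *
    simp at *
    refine ⟨⟨?_, ?_, ?_, ?_⟩, ?_⟩ <;> first | assumption | linarith
  have hLL := map_of_omul_self hD omul_octL_octL
  have hLI := map_of_anticomm hD omul_octL_octI
  have hLJ := map_of_anticomm hD omul_octL_octJ
  have hLK := map_of_anticomm hD omul_octL_octK
  rw [hI] at hLI
  rw [hJ] at hLJ
  rw [map_omul_eq_zero hD hI hJ] at hLK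
  have hL : D octL = 0 := by
    clear hII hJJ hIJ hI hJ hu hv h1 h2 h3
    generalize D octL = y at *
    obtain ⟨a, b⟩ := y
    simp only [octI, octJ, octL, omul, Prod.ext_iff, Quaternion.ext_iff] at *
    simp at *
    refine ⟨⟨?_, ?_, ?_, ?_⟩, ?_, ?_, ?_, ?_⟩ <;> first | assumption | linarith
  exact eq_zero_of_generators hD hI hJ hL

/-- The purely imaginary quaternion with given coordinates. -/
def imQ (p : Fin 3 → ℝ) : ℍ[ℝ] := quat 0 (p 0) (p 1) (p 2)

/-- The twisted derivation of the quaternions, `φ (a c) = φ a * star c + φ c * a`, with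
`φ i = u` and `φ j = v`. -/
def twisted (u v a : ℍ[ℝ]) : ℍ[ℝ] :=
  a.imI • u + a.imJ • v + a.imK • (v * quat 0 1 0 0 - u * quat 0 0 1 0)

/-- The first component of the image of `ℓ` under a derivation. -/
def octLImage (u v : ℍ[ℝ]) : ℍ[ℝ] := quat 0 (-u.re) (-v.re) (v.imI - u.imJ)

/-- The value at `x` of the derivation with parameters `c`. -/
def derivFun (c : Coord) (x : Oct) : Oct :=
  (imQ c.2.1 * x.1 - x.1 * imQ c.2.1 + (x.2 * octLImage c.1.1 c.1.2 - twisted c.1.1 c.1.2 x.2),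
    twisted c.1.1 c.1.2 x.1 + (imQ c.2.1 * x.2 - x.2 * imQ c.2.1 + imQ c.2.2 * x.2))

/-- The linear map with parameters `c`, which is a derivation by `deriv_mem`. -/
def deriv : Coord →ₗ[ℝ] Oct →ₗ[ℝ] Oct :=
  LinearMap.mk₂ ℝ derivFun
    (by
      intro c d x
      ext <;> simp [derivFun, imQ, twisted, octLImage] <;> ring)
    (by
      intro r c x
      ext <;> simp [derivFun, imQ, twisted, octLImage] <;> ring)
    (by
      intro c x y
      ext <;> simp [derivFun, imQ, twisted, octLImage] <;> ring)
    (by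
      intro r c x
      ext <;> simp [derivFun, imQ, twisted, octLImage] <;> ring)

set_option maxHeartbeats 1000000 in
lemma deriv_mem (c : Coord) : deriv c ∈ octDer := by
  intro x y
  simp only [deriv, LinearMap.mk₂_apply]
  ext <;> simp [derivFun, imQ, twisted, octLImage, omul] <;> ring

lemma deriv_injective : Function.Injective deriv := by
  rw [← LinearMap.ker_eq_bot, LinearMap.ker_eq_bot']
  intro c hc
  have hI := LinearMap.congr_fun hc octI
  have hJ := LinearMap.congr_fun hc octJ
  have hL := LinearMap.congr_fun hc octL
  obtain ⟨⟨u, v⟩, ⟨p, t⟩⟩ := c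
  simp [deriv, derivFun, imQ, twisted, octLImage, octI, octJ, octL, Prod.ext_iff,
    Quaternion.ext_iff] at hI hJ hL
  simp only [Prod.mk_eq_zero, Quaternion.ext_iff, funext_iff, Fin.forall_fin_succ]
  simp
  grind

end octDer

/-- the derivation algebra of the octonions (the compact 𝔤₂) has dimension 14. -/
theorem finrank_octDer : Module.finrank ℝ ↥octDer = 14 := by
  apply le_antisymm
  · rw [← octDer.finrank_coord]
    refine LinearMap.finrank_le_finrank_of_injective
      (f := octDer.coords ∘ₗ octDer.subtype) ?_
    rw [injective_iff_map_eq_zero]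
    intro D hD
    exact Subtype.ext (octDer.eq_zero_of_coords_eq_zero D.2 hD)
  · rw [← octDer.finrank_coord]
    refine LinearMap.finrank_le_finrank_of_injective
      (f := octDer.deriv.codRestrict octDer octDer.deriv_mem) ?_
    exact fun c d h => octDer.deriv_injective (congrArg Subtype.val h)
end
end

section
/- Every derivation of the Albert algebra decomposes uniquely: if Δ : H₃(𝕆) → H₃(𝕆) is ℝ-linear with Δ(X∘Y) = Δ(X)∘Y + X∘Δ(Y) for all X,Y, then there exist a unique derivation D of 𝕆 (an ℝ-linear map with D(x·y) = D(x)·y + x·D(y)) and a unique 3×3 octonionic matrix A that is skew-Hermitian (conj(A)ᵀ = −A) with trace zero (A₁₁ + A₂₂ + A₃₃ = 0, each diagonal entry being a purely imaginary octonion), such that Δ(X) = D̃(X) + (AX − XA) for all X, where D̃ applies D to every entry of X and AX, XA are octonionic matrix products. -/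
/- Octonions via the Cayley–Dickson construction over the quaternions. -/

noncomputable section

open Quaternion

lemma oconj_add (x y : Oct) : oconj (x + y) = oconj x + oconj y := by
  simp only [oconj, Prod.fst_add, Prod.snd_add, Prod.mk_add_mk, Prod.mk.injEq]
  exact ⟨star_add _ _, by abel⟩

lemma oconj_smul (r : ℝ) (x : Oct) : oconj (r • x) = r • oconj x := by
  simp [oconj, Prod.ext_iff, Quaternion.star_smul]

lemma oconj_sum {ι : Type*} (s : Finset ι) (f : ι → Oct) :
    oconj (∑ i ∈ s, f i) = ∑ i ∈ s, oconj (f i) :=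
  map_sum (AddMonoidHom.mk' oconj oconj_add) f s

lemma oconj_omul (x y : Oct) : oconj (omul x y) = omul (oconj y) (oconj x) := by
  simp only [oconj, omul, Prod.mk.injEq]
  constructor
  · simp [star_sub, star_mul, star_star, neg_mul_neg, star_neg]
  · simp only [star_star, neg_mul, mul_neg, neg_add, neg_neg]
    abel

/-- Octonionic conjugate-transpose of a 3×3 matrix. -/
def octConjT (A : Matrix (Fin 3) (Fin 3) Oct) : Matrix (Fin 3) (Fin 3) Oct :=
  Matrix.of fun i j => oconj (A j i)

/-- Multiplication of 3×3 octonionic matrices. -/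
def mmul (A B : Matrix (Fin 3) (Fin 3) Oct) : Matrix (Fin 3) (Fin 3) Oct :=
  Matrix.of fun i j => ∑ k : Fin 3, omul (A i k) (B k j)

lemma octConjT_add (A B : Matrix (Fin 3) (Fin 3) Oct) :
    octConjT (A + B) = octConjT A + octConjT B := by
  refine Matrix.ext fun i j => ?_
  simp [octConjT, oconj_add]

lemma octConjT_smul (r : ℝ) (A : Matrix (Fin 3) (Fin 3) Oct) :
    octConjT (r • A) = r • octConjT A := by
  refine Matrix.ext fun i j => ?_
  simp [octConjT, oconj_smul]

lemma octConjT_mmul (A B : Matrix (Fin 3) (Fin 3) Oct) :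
    octConjT (mmul A B) = mmul (octConjT B) (octConjT A) := by
  refine Matrix.ext fun i j => ?_
  simp [octConjT, mmul, oconj_sum, oconj_omul]

lemma mmul_add_left (A B C : Matrix (Fin 3) (Fin 3) Oct) :
    mmul (A + B) C = mmul A C + mmul B C := by
  refine Matrix.ext fun i j => ?_
  simp [mmul, omul_add_left, Finset.sum_add_distrib]

lemma mmul_add_right (A B C : Matrix (Fin 3) (Fin 3) Oct) :
    mmul A (B + C) = mmul A B + mmul A C := by
  refine Matrix.ext fun i j => ?_
  simp [mmul, omul_add_right, Finset.sum_add_distrib]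

lemma mmul_smul_left (r : ℝ) (A B : Matrix (Fin 3) (Fin 3) Oct) :
    mmul (r • A) B = r • mmul A B := by
  refine Matrix.ext fun i j => ?_
  simp [mmul, omul_smul_left, Finset.smul_sum]

lemma mmul_smul_right (r : ℝ) (A B : Matrix (Fin 3) (Fin 3) Oct) :
    mmul A (r • B) = r • mmul A B := by
  refine Matrix.ext fun i j => ?_
  simp [mmul, omul_smul_right, Finset.smul_sum]

lemma mmul_zero_left (B : Matrix (Fin 3) (Fin 3) Oct) : mmul 0 B = 0 := by
  refine Matrix.ext fun i j => ?_
  simp [mmul, omul_zero_left]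

lemma mmul_zero_right (A : Matrix (Fin 3) (Fin 3) Oct) : mmul A 0 = 0 := by
  refine Matrix.ext fun i j => ?_
  simp [mmul, omul_zero_right]

/-- The 27-dimensional real vector space of 3×3 octonionic Hermitian matrices. -/
def hermSubmodule : Submodule ℝ (Matrix (Fin 3) (Fin 3) Oct) where
  carrier := {A | octConjT A = A}
  zero_mem' := by
    show octConjT 0 = 0
    refine Matrix.ext fun i j => ?_
    simp [octConjT, oconj, Prod.ext_iff]
  add_mem' := by
    intro A B hA hB
    show octConjT (A + B) = A + B
    rw [octConjT_add]
    rw [Set.mem_setOf_eq] at hA hB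
    rw [hA, hB]
  smul_mem' := by
    intro r A hA
    show octConjT (r • A) = r • A
    rw [octConjT_smul]
    rw [Set.mem_setOf_eq] at hA
    rw [hA]

lemma mem_hermSubmodule {A : Matrix (Fin 3) (Fin 3) Oct} :
    A ∈ hermSubmodule ↔ octConjT A = A := Iff.rfl

/-- The Albert algebra `H₃(𝕆)` as a type: 3×3 octonionic Hermitian matrices. -/
def H3 : Type := ↥hermSubmodule

instance : AddCommGroup H3 := Submodule.addCommGroup hermSubmodule
instance : Module ℝ H3 := Submodule.module hermSubmodule

/-- The underlying octonionic matrix of an element of `H₃(𝕆)`. -/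
def H3.mat (X : H3) : Matrix (Fin 3) (Fin 3) Oct := Subtype.val X

lemma H3.isHerm (X : H3) : octConjT X.mat = X.mat := X.2

/-- The Jordan product X∘Y = (1/2)(XY + YX) on `H₃(𝕆)`. -/
def jmul (X Y : H3) : H3 :=
  ⟨(1/2 : ℝ) • (mmul X.mat Y.mat + mmul Y.mat X.mat), by
    have hX : octConjT X.mat = X.mat := X.isHerm
    have hY : octConjT Y.mat = Y.mat := Y.isHerm
    rw [mem_hermSubmodule, octConjT_smul, octConjT_add, octConjT_mmul, octConjT_mmul,
      hX, hY, add_comm]⟩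

/-- The trace of an element of `H₃(𝕆)` (the sum of its real diagonal entries). -/
def htrace (X : H3) : ℝ := (X.mat 0 0).1.re + (X.mat 1 1).1.re + (X.mat 2 2).1.re

/-- Entrywise application of a map `D : 𝕆 → 𝕆` to a 3×3 octonionic matrix. -/
def octEntrywise (D : Oct →ₗ[ℝ] Oct) (A : Matrix (Fin 3) (Fin 3) Oct) :
    Matrix (Fin 3) (Fin 3) Oct :=
  Matrix.of fun i j => D (A i j)

lemma omul_neg_left (x y : Oct) : omul (-x) y = -omul x y := by
  simpa using omul_smul_left (-1) x y

lemma omul_neg_right (x y : Oct) : omul x (-y) = -omul x y := by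
  simpa using omul_smul_right (-1) x y

lemma omul_sub_left (x x' y : Oct) : omul (x - x') y = omul x y - omul x' y := by
  rw [sub_eq_add_neg, omul_add_left, omul_neg_left, ← sub_eq_add_neg]

lemma omul_sub_right (x y y' : Oct) : omul x (y - y') = omul x y - omul x y' := by
  rw [sub_eq_add_neg, omul_add_right, omul_neg_right, ← sub_eq_add_neg]

lemma oone_omul (x : Oct) : omul oone x = x := by
  simp [omul, oone]

lemma omul_oone (x : Oct) : omul x oone = x := by
  simp [omul, oone]

lemma oconj_oone : oconj oone = oone := by
  simp [oconj, oone]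

lemma oconj_zero : oconj 0 = 0 := by
  simp [oconj, Prod.ext_iff]

lemma oconj_neg (x : Oct) : oconj (-x) = -oconj x := by
  simpa using oconj_smul (-1) x

lemma oconj_oconj (x : Oct) : oconj (oconj x) = x := by
  simp [oconj]

lemma omul_oconj_self (x : Oct) : omul x (oconj x) = onorm x • oone := by
  ext <;> simp [omul, oconj, oone, onorm, Quaternion.normSq_def'] <;> ring

lemma oconj_omul_self (x : Oct) : omul (oconj x) x = onorm x • oone := by
  ext <;> simp [omul, oconj, oone, onorm, Quaternion.normSq_def'] <;> ring

/-- A self-conjugate octonion is real. -/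
lemma eq_smul_oone_of_oconj_eq {x : Oct} (h : oconj x = x) : x = x.1.re • oone := by
  have h1 : star x.1 = x.1 := congrArg Prod.fst h
  have h2 : -x.2 = x.2 := congrArg Prod.snd h
  refine Prod.ext ?_ ?_
  · rw [Quaternion.star_eq_self] at h1
    rw [h1]
    ext <;> simp [oone]
  · have h3 : (2 : ℝ) • x.2 = 0 := by
      rw [two_smul]
      nth_rewrite 1 [← h2]
      exact neg_add_cancel _
    simpa [oone] using h3

/-- The associator of the octonions. -/
def oassoc (x y z : Oct) : Oct := omul (omul x y) z - omul x (omul y z)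

set_option maxHeartbeats 2000000 in
lemma oassoc_self_left (x y : Oct) : oassoc x x y = 0 := by
  ext <;> simp [oassoc, omul] <;> ring

lemma oassoc_self_right (x y : Oct) : oassoc x y y = 0 := by
  have h := congrArg oconj (oassoc_self_left (oconj y) (oconj x))
  simp only [oassoc, sub_eq_add_neg, oconj_add, oconj_neg, oconj_omul, oconj_oconj,
    oconj_zero] at h ⊢
  linear_combination (norm := abel) -h

lemma oassoc_swap_left (x y z : Oct) : oassoc y x z = -oassoc x y z := by
  have h := oassoc_self_left (x + y) z
  have hx := oassoc_self_left x z
  have hy := oassoc_self_left y z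
  simp only [oassoc, omul_add_left, omul_add_right] at h hx hy ⊢
  linear_combination (norm := abel) h - hx - hy

lemma oassoc_swap_right (x y z : Oct) : oassoc x z y = -oassoc x y z := by
  have h := oassoc_self_right x (y + z)
  have hy := oassoc_self_right x y
  have hz := oassoc_self_right x z
  simp only [oassoc, omul_add_left, omul_add_right] at h hy hz ⊢
  linear_combination (norm := abel) h - hy - hz

namespace H3

@[ext] lemma ext {X Y : H3} (h : ∀ i j, X.mat i j = Y.mat i j) : X = Y :=
  Subtype.ext (Matrix.ext h)

lemma mat_add (X Y : H3) (i j : Fin 3) : (X + Y).mat i j = X.mat i j + Y.mat i j := rfl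

lemma mat_smul (r : ℝ) (X : H3) (i j : Fin 3) : (r • X).mat i j = r • X.mat i j := rfl

lemma mat_zero (i j : Fin 3) : (0 : H3).mat i j = 0 := rfl

lemma oconj_mat (X : H3) (i j : Fin 3) : oconj (X.mat i j) = X.mat j i :=
  congrFun (congrFun X.isHerm j) i

/-- The Hermitian matrix with `x` in position `(i, j)` and `oconj x` in position `(j, i)`
(these two contributions are added when `i = j`). -/
def single (i j : Fin 3) (x : Oct) : H3 :=
  ⟨Matrix.single i j x + Matrix.single j i (oconj x), by
    rw [mem_hermSubmodule]
    refine Matrix.ext fun a b => ?_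
    simp only [octConjT, Matrix.of_apply, Matrix.add_apply, Matrix.single_apply, oconj_add,
      apply_ite oconj, oconj_oconj, oconj_zero]
    simp only [add_comm, and_comm]⟩

/-- The diagonal idempotents of the Albert algebra. -/
def idem (i : Fin 3) : H3 :=
  ⟨Matrix.single i i oone, by
    rw [mem_hermSubmodule]
    refine Matrix.ext fun a b => ?_
    simp only [octConjT, Matrix.of_apply, Matrix.single_apply, apply_ite oconj, oconj_zero,
      oconj_oone, and_comm]⟩

lemma mat_single (i j : Fin 3) (x : Oct) (a b : Fin 3) :
    (single i j x).mat a b =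
      (if i = a ∧ j = b then x else 0) + (if j = a ∧ i = b then oconj x else 0) := by
  simp [single, mat, Matrix.single_apply]

lemma mat_idem (i a b : Fin 3) : (idem i).mat a b = if i = a ∧ i = b then oone else 0 := by
  simp [idem, mat, Matrix.single_apply]

lemma single_swap (i j : Fin 3) (x : Oct) : single j i (oconj x) = single i j x := by
  ext1 a b
  rw [mat_single, mat_single, oconj_oconj, add_comm]

lemma single_add (i j : Fin 3) (x y : Oct) :
    single i j (x + y) = single i j x + single i j y := by
  ext1 a b
  simp only [mat_single, mat_add, oconj_add]
  split_ifs <;> abel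

lemma single_smul (i j : Fin 3) (r : ℝ) (x : Oct) :
    single i j (r • x) = r • single i j x := by
  ext1 a b
  simp only [mat_single, mat_smul, oconj_smul, smul_add, smul_ite, smul_zero]

lemma mmul_matrixSingle_left (i j : Fin 3) (x : Oct) (M : Matrix (Fin 3) (Fin 3) Oct)
    (a b : Fin 3) :
    mmul (Matrix.single i j x) M a b = if i = a then omul x (M j b) else 0 := by
  simp only [mmul, Matrix.of_apply]
  rw [Finset.sum_eq_single j]
  · by_cases h : i = a <;> simp [h, omul_zero_left]
  · intro k _ hk
    simp [hk.symm, omul_zero_left]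
  · simp

lemma mmul_matrixSingle_right (i j : Fin 3) (x : Oct) (M : Matrix (Fin 3) (Fin 3) Oct)
    (a b : Fin 3) :
    mmul M (Matrix.single i j x) a b = if j = b then omul (M a i) x else 0 := by
  simp only [mmul, Matrix.of_apply]
  rw [Finset.sum_eq_single i]
  · by_cases h : j = b <;> simp [h, omul_zero_right]
  · intro k _ hk
    simp [hk.symm, omul_zero_right]
  · simp

lemma single_mmul (i j : Fin 3) (x : Oct) (M : Matrix (Fin 3) (Fin 3) Oct) (a b : Fin 3) :
    mmul (single i j x).mat M a b =
      (if i = a then omul x (M j b) else 0) + (if j = a then omul (oconj x) (M i b) else 0) := by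
  simp only [single, mat, mmul_add_left, Matrix.add_apply, mmul_matrixSingle_left]

lemma mmul_single (i j : Fin 3) (x : Oct) (M : Matrix (Fin 3) (Fin 3) Oct) (a b : Fin 3) :
    mmul M (single i j x).mat a b =
      (if j = b then omul (M a i) x else 0) + (if i = b then omul (M a j) (oconj x) else 0) := by
  simp only [single, mat, mmul_add_right, Matrix.add_apply, mmul_matrixSingle_right]

lemma idem_mmul (i : Fin 3) (M : Matrix (Fin 3) (Fin 3) Oct) (a b : Fin 3) :
    mmul (idem i).mat M a b = if i = a then M a b else 0 := by
  simp only [idem, mat, mmul_matrixSingle_left, oone_omul]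
  split_ifs with h <;> simp [h]

lemma mmul_idem (i : Fin 3) (M : Matrix (Fin 3) (Fin 3) Oct) (a b : Fin 3) :
    mmul M (idem i).mat a b = if i = b then M a b else 0 := by
  simp only [idem, mat, mmul_matrixSingle_right, omul_oone]
  split_ifs with h <;> simp [h]

lemma mat_jmul (X Y : H3) (a b : Fin 3) :
    (jmul X Y).mat a b = (1 / 2 : ℝ) • (mmul X.mat Y.mat a b + mmul Y.mat X.mat a b) := rfl

lemma idem_jmul_idem_self (i : Fin 3) : jmul (idem i) (idem i) = idem i := by
  ext1 a b
  rw [mat_jmul, idem_mmul, mat_idem]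
  obtain rfl | ha := eq_or_ne i a <;> obtain rfl | hb := eq_or_ne i b <;> simp [*]
  module

lemma idem_jmul_idem {i j : Fin 3} (h : i ≠ j) : jmul (idem i) (idem j) = 0 := by
  ext1 a b
  rw [mat_jmul, idem_mmul, mmul_idem, mat_idem, mat_zero]
  by_cases ha : i = a <;> by_cases hb : i = b <;> simp_all [eq_comm]

lemma idem_jmul_single {i j : Fin 3} (h : i ≠ j) (x : Oct) :
    jmul (idem i) (single i j x) = (1 / 2 : ℝ) • single i j x := by
  ext1 a b
  rw [mat_jmul, idem_mmul, mmul_idem, mat_smul, mat_single]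
  by_cases ha : i = a <;> by_cases hb : i = b <;> simp_all [eq_comm]

lemma idem_jmul_single_of_ne {i j k : Fin 3} (hi : k ≠ i) (hj : k ≠ j) (x : Oct) :
    jmul (idem k) (single i j x) = 0 := by
  ext1 a b
  rw [mat_jmul, idem_mmul, mmul_idem, mat_zero, mat_single]
  by_cases ha : k = a <;> by_cases hb : k = b <;> simp_all [eq_comm]

lemma single_jmul_single {i j k : Fin 3} (hij : i ≠ j) (hjk : j ≠ k) (hik : i ≠ k) (x y : Oct) :
    jmul (single i j x) (single j k y) = (1 / 2 : ℝ) • single i k (omul x y) := by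
  ext1 a b
  rw [mat_jmul, single_mmul, mmul_single, mat_smul]
  simp only [mat_single, oconj_omul]
  by_cases h1 : i = a <;> by_cases h2 : j = a <;> by_cases h3 : i = b <;> by_cases h4 : j = b <;>
    simp_all [eq_comm, omul_zero_left, omul_zero_right] <;>
    split_ifs <;> simp_all [omul_zero_left, omul_zero_right]

lemma single_jmul_self {i j : Fin 3} (h : i ≠ j) (x : Oct) :
    jmul (single i j x) (single i j x) = onorm x • (idem i + idem j) := by
  ext1 a b
  rw [mat_jmul, single_mmul, mat_smul, mat_add, mat_idem, mat_idem]
  simp only [mat_single]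
  by_cases h1 : i = a <;> by_cases h2 : j = a <;> by_cases h3 : i = b <;> by_cases h4 : j = b <;>
    simp_all [eq_comm, omul_zero_right, omul_oconj_self, oconj_omul_self] <;>
    module

/-- Decomposition of a Hermitian matrix into its diagonal and off-diagonal parts. -/
lemma eq_sum (X : H3) :
    X = (X.mat 0 0).1.re • idem 0 + (X.mat 1 1).1.re • idem 1 + (X.mat 2 2).1.re • idem 2 +
      single 0 1 (X.mat 0 1) + single 0 2 (X.mat 0 2) + single 1 2 (X.mat 1 2) := by
  have hd (i : Fin 3) : X.mat i i = (X.mat i i).1.re • oone :=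
    eq_smul_oone_of_oconj_eq (X.oconj_mat i i)
  ext1 a b
  simp only [mat_add, mat_smul, mat_idem, mat_single, oconj_mat]
  fin_cases a <;> fin_cases b <;> simp <;> exact hd _

/-- Derivations of the Albert algebra. -/
def IsDerivation (Δ : H3 →ₗ[ℝ] H3) : Prop :=
  ∀ X Y : H3, Δ (jmul X Y) = jmul (Δ X) Y + jmul X (Δ Y)

namespace IsDerivation

variable {Δ : H3 →ₗ[ℝ] H3} {i j k : Fin 3}

lemma idem_apply_self (h : IsDerivation Δ) (i : Fin 3) : (Δ (idem i)).mat i i = 0 := by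
  have h1 := congrArg (fun X => X.mat i i) (h (idem i) (idem i))
  simp only [idem_jmul_idem_self, mat_add, mat_jmul, idem_mmul, mmul_idem, if_true] at h1
  linear_combination (norm := module) -h1

lemma idem_apply_of_ne (h : IsDerivation Δ) (hj : i ≠ j) (hk : i ≠ k) :
    (Δ (idem i)).mat j k = 0 := by
  have h1 := congrArg (fun X => X.mat j k) (h (idem i) (idem i))
  simp only [idem_jmul_idem_self, mat_add, mat_jmul, idem_mmul, mmul_idem, hj, hk, if_false] at h1
  linear_combination (norm := module) h1

lemma idem_apply_swap (h : IsDerivation Δ) (hij : i ≠ j) :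
    (Δ (idem i)).mat i j = -(Δ (idem j)).mat i j := by
  have h1 := congrArg (fun X => X.mat i j) (h (idem i) (idem j))
  simp only [idem_jmul_idem hij, map_zero, mat_zero, mat_add, mat_jmul, idem_mmul, mmul_idem, hij,
    hij.symm, if_false, if_true] at h1
  linear_combination (norm := module) -(2 : ℝ) • h1

lemma single_apply_diag (h : IsDerivation Δ) (hij : i ≠ j) (x : Oct) :
    (Δ (single i j x)).mat i i =
      omul ((Δ (idem j)).mat i j) (oconj x) - omul x ((Δ (idem i)).mat j i) := by
  have h1 := congrArg (fun X => X.mat i i) (h (idem i) (single i j x))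
  simp only [idem_jmul_single hij, map_smul, mat_smul, mat_add, mat_jmul, idem_mmul, mmul_idem,
    single_mmul, mmul_single, hij.symm, if_false, if_true, h.idem_apply_swap hij,
    omul_neg_left] at h1
  linear_combination (norm := module) -(2 : ℝ) • h1

lemma single_apply_opposite (h : IsDerivation Δ) (hik : i ≠ k) (hjk : j ≠ k) (x : Oct) :
    (Δ (single i j x)).mat k k = 0 := by
  have h1 := congrArg (fun X => X.mat k k) (h (idem k) (single i j x))
  simp only [idem_jmul_single_of_ne hik.symm hjk.symm, map_zero, mat_zero, mat_add, mat_jmul,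
    idem_mmul, mmul_idem, single_mmul, mmul_single, hik, hjk, if_false, if_true] at h1
  linear_combination (norm := module) -h1

lemma single_apply_row (h : IsDerivation Δ) (hij : i ≠ j) (hik : i ≠ k) (hjk : j ≠ k) (x : Oct) :
    (Δ (single i j x)).mat i k = -omul x ((Δ (idem k)).mat j k) := by
  have h1 := congrArg (fun X => X.mat i k) (h (idem k) (single i j x))
  simp only [idem_jmul_single_of_ne hik.symm hjk.symm, map_zero, mat_zero, mat_add, mat_jmul,
    idem_mmul, mmul_idem, single_mmul, mmul_single, hij.symm, hik, hik.symm, hjk, if_false,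
    if_true] at h1
  linear_combination (norm := module) -(2 : ℝ) • h1

/-- The off-diagonal blocks of a derivation satisfy infinitesimal triality. -/
lemma single_apply_omul (h : IsDerivation Δ) (hij : i ≠ j) (hik : i ≠ k) (hjk : j ≠ k)
    (x y : Oct) :
    (Δ (single i k (omul x y))).mat i k =
      omul ((Δ (single i j x)).mat i j) y + omul x ((Δ (single j k y)).mat j k) := by
  have h1 := congrArg (fun X => X.mat i k) (h (single i j x) (single j k y))
  simp only [single_jmul_single hij hjk hik, map_smul, mat_smul, mat_add, mat_jmul, single_mmul,
    mmul_single, hij.symm, hik, hik.symm, hjk, if_false, if_true] at h1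
  linear_combination (norm := module) (2 : ℝ) • h1

lemma single_oconj_apply (Δ : H3 →ₗ[ℝ] H3) (i j : Fin 3) (x : Oct) :
    (Δ (single j i (oconj x))).mat j i = oconj ((Δ (single i j x)).mat i j) := by
  rw [single_swap, oconj_mat]

lemma oconj_single_oone_apply (h : IsDerivation Δ) (hij : i ≠ j) :
    oconj ((Δ (single i j oone)).mat i j) = -(Δ (single i j oone)).mat i j := by
  have h1 := congrArg (fun X => X.mat i i) (h (single i j oone) (single i j oone))
  simp only [single_jmul_self hij, map_smul, map_add, mat_smul, mat_add, mat_jmul, single_mmul,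
    mmul_single, hij.symm, if_false, if_true, h.idem_apply_self,
    h.idem_apply_of_ne hij.symm hij.symm, oconj_oone, oone_omul, omul_oone] at h1
  rw [oconj_mat]
  linear_combination (norm := module) -h1

lemma single_oone_apply_swap (h : IsDerivation Δ) (hij : i ≠ j) :
    (Δ (single j i oone)).mat j i = -(Δ (single i j oone)).mat i j := by
  rw [← h.oconj_single_oone_apply hij, ← single_oconj_apply, oconj_oone]

lemma single_oone_apply_add (h : IsDerivation Δ) (hij : i ≠ j) (hik : i ≠ k) (hjk : j ≠ k) :
    (Δ (single i k oone)).mat i k =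
      (Δ (single i j oone)).mat i j + (Δ (single j k oone)).mat j k := by
  simpa only [omul_oone, oone_omul] using h.single_apply_omul hij hik hjk oone oone

/-- If `D` and `A` give the right values on the idempotents and the right diagonal blocks, then
they represent `Δ` on all off-diagonal matrices. -/
lemma mat_single_eq (h : IsDerivation Δ) {D : Oct →ₗ[ℝ] Oct} {A : Matrix (Fin 3) (Fin 3) Oct}
    (hA : ∀ i j, i ≠ j → A i j = (Δ (idem j)).mat i j)
    (hD : ∀ i j, i ≠ j → ∀ x,
      (Δ (single i j x)).mat i j = D x + omul (A i i) x - omul x (A j j))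
    (hij : i ≠ j) (x : Oct) :
    (Δ (single i j x)).mat =
      octEntrywise D (single i j x).mat +
        (mmul A (single i j x).mat - mmul (single i j x).mat A) := by
  have hrow : ∀ i j, i ≠ j → ∀ (x : Oct) (b : Fin 3), (Δ (single i j x)).mat i b =
      D ((single i j x).mat i b) +
        (mmul A (single i j x).mat i b - mmul (single i j x).mat A i b) := by
    intro i j hij x b
    rw [mmul_single, single_mmul, mat_single]
    by_cases hb : i = b
    · subst hb
      simp [hij.symm, h.single_apply_diag hij, hA _ _ hij, hA _ _ hij.symm]
    by_cases hb' : j = b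
    · subst hb'
      simp [hij, hij.symm, hD _ _ hij, add_sub_assoc]
    · simp [hij.symm, hb, hb', h.single_apply_row hij hb hb', hA _ _ hb']
  have hcol : ∀ i j k, i ≠ j → i ≠ k → j ≠ k → ∀ x : Oct, (Δ (single i j x)).mat k i =
      D ((single i j x).mat k i) +
        (mmul A (single i j x).mat k i - mmul (single i j x).mat A k i) := by
    intro i j k hij hik hjk x
    rw [mmul_single, single_mmul, mat_single, ← oconj_mat, h.single_apply_row hij hik hjk,
      oconj_neg, oconj_omul, oconj_mat, h.idem_apply_swap hjk.symm, ← hA _ _ hjk.symm]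
    simp [hij.symm, hik, hjk, omul_neg_left]
  refine Matrix.ext fun a b => ?_
  simp only [octEntrywise, Matrix.add_apply, Matrix.sub_apply, Matrix.of_apply]
  by_cases hai : i = a
  · exact hai ▸ hrow i j hij x b
  by_cases haj : j = a
  · rw [← single_swap]
    exact haj ▸ hrow j i hij.symm _ b
  by_cases hbi : i = b
  · exact hbi ▸ hcol i j a hij hai haj x
  by_cases hbj : j = b
  · rw [← single_swap]
    exact hbj ▸ hcol j i a hij.symm haj hai _
  · have hab : a = b := by omega
    subst hab
    rw [mmul_single, single_mmul, mat_single, h.single_apply_opposite hai haj]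
    simp [hai, haj]

lemma mat_idem_eq (h : IsDerivation Δ) {D : Oct →ₗ[ℝ] Oct} (hD : D oone = 0)
    {A : Matrix (Fin 3) (Fin 3) Oct} (hA : ∀ i j, i ≠ j → A i j = (Δ (idem j)).mat i j)
    (i : Fin 3) :
    (Δ (idem i)).mat =
      octEntrywise D (idem i).mat + (mmul A (idem i).mat - mmul (idem i).mat A) := by
  refine Matrix.ext fun a b => ?_
  simp only [octEntrywise, Matrix.add_apply, Matrix.sub_apply, Matrix.of_apply]
  rw [mmul_idem, idem_mmul, mat_idem, apply_ite D, hD, map_zero, ite_self, zero_add]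
  by_cases ha : i = a <;> by_cases hb : i = b
  · subst ha hb
    simp [h.idem_apply_self]
  · subst ha
    simp [hb, hA _ _ hb, h.idem_apply_swap hb]
  · subst hb
    simp [ha, hA _ _ (Ne.symm ha)]
  · simp [ha, hb, h.idem_apply_of_ne ha hb]

end IsDerivation

end H3

lemma oder_oone {D : Oct →ₗ[ℝ] Oct} (hD : ∀ x y, D (omul x y) = omul (D x) y + omul x (D y)) :
    D oone = 0 := by
  have h := hD oone oone
  rw [omul_oone, oone_omul, omul_oone] at h
  simpa using h

open H3

lemma eq_of_mat_idem_of_mat_single {Δ : H3 →ₗ[ℝ] H3} {D : Oct →ₗ[ℝ] Oct}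
    {A : Matrix (Fin 3) (Fin 3) Oct}
    (hi : ∀ i, (Δ (idem i)).mat =
      octEntrywise D (idem i).mat + (mmul A (idem i).mat - mmul (idem i).mat A))
    (hs : ∀ i j, i ≠ j → ∀ x, (Δ (single i j x)).mat =
      octEntrywise D (single i j x).mat + (mmul A (single i j x).mat - mmul (single i j x).mat A))
    (X : H3) :
    (Δ X).mat = octEntrywise D X.mat + (mmul A X.mat - mmul X.mat A) := by
  have hadd (X Y : H3)
      (hX : (Δ X).mat = octEntrywise D X.mat + (mmul A X.mat - mmul X.mat A))
      (hY : (Δ Y).mat = octEntrywise D Y.mat + (mmul A Y.mat - mmul Y.mat A)) :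
      (Δ (X + Y)).mat =
        octEntrywise D (X + Y).mat + (mmul A (X + Y).mat - mmul (X + Y).mat A) := by
    have h1 : (X + Y).mat = X.mat + Y.mat := rfl
    have h2 : (Δ X + Δ Y).mat = (Δ X).mat + (Δ Y).mat := rfl
    have h3 : octEntrywise D (X.mat + Y.mat) = octEntrywise D X.mat + octEntrywise D Y.mat :=
      Matrix.ext fun _ _ => D.map_add _ _
    rw [map_add, h1, h2, h3, hX, hY, mmul_add_left, mmul_add_right]
    abel
  have hsmul (r : ℝ) (X : H3)
      (hX : (Δ X).mat = octEntrywise D X.mat + (mmul A X.mat - mmul X.mat A)) :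
      (Δ (r • X)).mat =
        octEntrywise D (r • X).mat + (mmul A (r • X).mat - mmul (r • X).mat A) := by
    have h1 : (r • X).mat = r • X.mat := rfl
    have h2 : (r • Δ X).mat = r • (Δ X).mat := rfl
    have h3 : octEntrywise D (r • X.mat) = r • octEntrywise D X.mat :=
      Matrix.ext fun _ _ => D.map_smul _ _
    rw [map_smul, h1, h2, h3, hX, mmul_smul_left, mmul_smul_right]
    module
  rw [eq_sum X]
  exact hadd _ _ (hadd _ _ (hadd _ _ (hadd _ _ (hadd _ _ (hsmul _ _ (hi 0)) (hsmul _ _ (hi 1)))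
    (hsmul _ _ (hi 2))) (hs 0 1 (by decide) _)) (hs 0 2 (by decide) _)) (hs 1 2 (by decide) _)

/-- The principle of infinitesimal triality: a triple of maps satisfying the triality relation
comes from a derivation of the octonions once the multiplication operators are split off. -/
lemma oder_of_triality {D : Oct →ₗ[ℝ] Oct} {p q r : Oct} (hsum : p + q + r = 0)
    (h : ∀ x y, D (omul x y) + omul p (omul x y) - omul (omul x y) r =
      omul (D x + omul p x - omul x q) y + omul x (D y + omul q y - omul y r)) (x y : Oct) :
    D (omul x y) = omul (D x) y + omul x (D y) := by
  have hp := oassoc_swap_left p x y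
  have hp' := oassoc_swap_right x p y
  have hq := oassoc_swap_right x q y
  have hs : oassoc x y (p + q + r) = 0 := by
    rw [hsum, oassoc, omul_zero_right, omul_zero_right, omul_zero_right, sub_zero]
  have hxy := h x y
  simp only [oassoc, omul_add_left, omul_add_right, omul_sub_left, omul_sub_right]
    at hp hp' hq hs hxy ⊢
  linear_combination (norm := abel) hxy + hs - hq - hp' + hp

/-- A derivation of the Albert algebra has a decomposition. -/
lemma H3.IsDerivation.exists_decomposition {Δ : H3 →ₗ[ℝ] H3} (h : IsDerivation Δ) :
    ∃ (D : Oct →ₗ[ℝ] Oct) (A : Matrix (Fin 3) (Fin 3) Oct),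
      ((∀ x y : Oct, D (omul x y) = omul (D x) y + omul x (D y)) ∧
        octConjT A = -A ∧ A 0 0 + A 1 1 + A 2 2 = 0) ∧
      ∀ X : H3, (Δ X).mat = octEntrywise D X.mat + (mmul A X.mat - mmul X.mat A) := by
  have h01 : (0 : Fin 3) ≠ 1 := by decide
  have h02 : (0 : Fin 3) ≠ 2 := by decide
  have h12 : (1 : Fin 3) ≠ 2 := by decide
  obtain ⟨p, hpconj, hpsum, hp⟩ : ∃ p : Fin 3 → Oct, (∀ i, oconj (p i) = -p i) ∧
      p 0 + p 1 + p 2 = 0 ∧ ∀ i j, i ≠ j → (Δ (single i j oone)).mat i j = p i - p j := by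
    have e02 := h.single_oone_apply_add h01 h02 h12
    have e10 := h.single_oone_apply_swap h01
    have e20 := h.single_oone_apply_swap h02
    have e21 := h.single_oone_apply_swap h12
    have c01 := h.oconj_single_oone_apply h01
    have c12 := h.oconj_single_oone_apply h12
    set a := (Δ (single 0 1 oone)).mat 0 1
    set b := (Δ (single 1 2 oone)).mat 1 2
    have hconj (s t : ℝ) : oconj (s • a + t • b) = -(s • a + t • b) := by
      rw [oconj_add, oconj_smul, oconj_smul, c01, c12]
      module
    refine ⟨![(2 / 3 : ℝ) • a + (1 / 3 : ℝ) • b, (-1 / 3 : ℝ) • a + (1 / 3 : ℝ) • b,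
      (-1 / 3 : ℝ) • a + (-2 / 3 : ℝ) • b], ?_, ?_, ?_⟩
    · intro i
      fin_cases i <;> exact hconj _ _
    · simp only [Matrix.cons_val]
      module
    · intro i j hij
      fin_cases i <;> fin_cases j <;> simp at hij ⊢
      all_goals simp only [e02, e10, e20, e21, a, b]
      all_goals module
  let D : Oct →ₗ[ℝ] Oct :=
    { toFun := fun x => (Δ (single 0 1 x)).mat 0 1 - omul (p 0) x + omul x (p 1)
      map_add' := fun x y => by
        simp only [single_add, map_add, mat_add, omul_add_left, omul_add_right]
        abel
      map_smul' := fun r x => by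
        simp only [single_smul, map_smul, mat_smul, omul_smul_left, omul_smul_right,
          RingHom.id_apply]
        module }
  let A : Matrix (Fin 3) (Fin 3) Oct :=
    Matrix.of fun i j => if i = j then p i else (Δ (idem j)).mat i j
  have hAdiag (i : Fin 3) : A i i = p i := by simp [A]
  have hA (i j : Fin 3) (hij : i ≠ j) : A i j = (Δ (idem j)).mat i j := by simp [A, hij]
  have hfst (i j k : Fin 3) (hij : i ≠ j) (hik : i ≠ k) (hjk : j ≠ k) (x : Oct) :
      (Δ (single i k x)).mat i k + omul x (p k) = (Δ (single i j x)).mat i j + omul x (p j) := by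
    have h1 := h.single_apply_omul hij hik hjk x oone
    rw [omul_oone, omul_oone, hp _ _ hjk, omul_sub_right] at h1
    rw [h1]
    abel
  have hsnd (i j k : Fin 3) (hij : i ≠ j) (hik : i ≠ k) (hjk : j ≠ k) (x : Oct) :
      (Δ (single i k x)).mat i k - omul (p i) x = (Δ (single j k x)).mat j k - omul (p j) x := by
    have h1 := h.single_apply_omul hij hik hjk oone x
    rw [oone_omul, oone_omul, hp _ _ hij, omul_sub_left] at h1
    rw [h1]
    abel
  have hT (i j : Fin 3) (hij : i ≠ j) (x : Oct) :
      (Δ (single i j x)).mat i j = D x + omul (A i i) x - omul x (A j j) := by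
    simp only [hAdiag, D, LinearMap.coe_mk, AddHom.coe_mk]
    have e02 := hfst 0 1 2 h01 h02 h12 x
    have e12 := hsnd 0 1 2 h01 h02 h12 x
    have e10 := hfst 1 0 2 h01.symm h12 h02 x
    have e20 := hsnd 2 1 0 h12.symm h02.symm h01.symm x
    have e21 := hfst 2 0 1 h02.symm h12.symm h01 x
    fin_cases i <;> fin_cases j <;> simp at hij ⊢
    · abel
    · linear_combination (norm := abel) e02
    · linear_combination (norm := abel) e02 - e12 - e10
    · linear_combination (norm := abel) e02 - e12
    · linear_combination (norm := abel) e02 - e12 - e10 + e20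
    · linear_combination (norm := abel) e02 - e12 - e10 + e20 + e21
  have hD : ∀ x y : Oct, D (omul x y) = omul (D x) y + omul x (D y) := by
    refine oder_of_triality hpsum fun x y => ?_
    have h1 := h.single_apply_omul h01 h02 h12 x y
    rw [hT _ _ h01, hT _ _ h02, hT _ _ h12, hAdiag, hAdiag, hAdiag] at h1
    exact h1
  refine ⟨D, A, ⟨hD, Matrix.ext fun i j => ?_, ?_⟩,
    eq_of_mat_idem_of_mat_single (h.mat_idem_eq (oder_oone hD) hA)
      fun i j hij x => h.mat_single_eq hA hT hij x⟩
  · rw [octConjT, Matrix.of_apply, Matrix.neg_apply]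
    obtain rfl | hij := eq_or_ne i j
    · rw [hAdiag, hpconj]
    · rw [hA _ _ hij, hA _ _ hij.symm, oconj_mat, h.idem_apply_swap hij]
  · rw [hAdiag, hAdiag, hAdiag, hpsum]

/-- The components of a decomposition are determined by the map it represents. -/
lemma decomposition_unique {Δ : H3 →ₗ[ℝ] H3} {D D' : Oct →ₗ[ℝ] Oct}
    {A A' : Matrix (Fin 3) (Fin 3) Oct} (hD : D oone = 0) (hD' : D' oone = 0)
    (htr : A 0 0 + A 1 1 + A 2 2 = 0) (htr' : A' 0 0 + A' 1 1 + A' 2 2 = 0)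
    (h : ∀ X : H3, (Δ X).mat = octEntrywise D X.mat + (mmul A X.mat - mmul X.mat A))
    (h' : ∀ X : H3, (Δ X).mat = octEntrywise D' X.mat + (mmul A' X.mat - mmul X.mat A')) :
    D = D' ∧ A = A' := by
  have hoff (i j : Fin 3) (hij : i ≠ j) : A i j = A' i j := by
    have h1 := congrFun (congrFun ((h (idem j)).symm.trans (h' (idem j))) i) j
    simpa [octEntrywise, mmul_idem, idem_mmul, mat_idem, hij.symm] using h1
  have hsingle (i j : Fin 3) (hij : i ≠ j) (x : Oct) :
      D x + (omul (A i i) x - omul x (A j j)) = D' x + (omul (A' i i) x - omul x (A' j j)) := by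
    have h1 := congrFun (congrFun ((h (single i j x)).symm.trans (h' (single i j x))) i) j
    simpa [octEntrywise, mmul_single, single_mmul, mat_single, hij, hij.symm] using h1
  have hdiff (i j : Fin 3) (hij : i ≠ j) : A i i - A j j = A' i i - A' j j := by
    simpa [hD, hD', oone_omul, omul_oone] using hsingle i j hij oone
  have h01 := hdiff 0 1 (by decide)
  have h02 := hdiff 0 2 (by decide)
  have h00 : A 0 0 = A' 0 0 := by
    linear_combination (norm := module) (1 / 3 : ℝ) • (h01 + h02 + htr - htr')
  have h11 : A 1 1 = A' 1 1 := by linear_combination (norm := abel) h00 - h01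
  have h22 : A 2 2 = A' 2 2 := by linear_combination (norm := abel) h00 - h02
  refine ⟨LinearMap.ext fun x => ?_, Matrix.ext fun i j => ?_⟩
  · have h1 := hsingle 0 1 (by decide) x
    rw [h00, h11] at h1
    exact add_right_cancel h1
  · obtain rfl | hij := eq_or_ne i j
    · fin_cases i
      exacts [h00, h11, h22]
    · exact hoff i j hij

/-- every derivation of the Albert algebra decomposes uniquely as an
entrywise octonionic derivation plus the commutator with a traceless skew-Hermitian
octonionic matrix. -/
theorem albert_derivation_decomposition (Δ : H3 →ₗ[ℝ] H3)
    (hder : ∀ X Y : H3, Δ (jmul X Y) = jmul (Δ X) Y + jmul X (Δ Y)) :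
    ∃! p : (Oct →ₗ[ℝ] Oct) × Matrix (Fin 3) (Fin 3) Oct,
      ((∀ x y : Oct, p.1 (omul x y) = omul (p.1 x) y + omul x (p.1 y)) ∧
        octConjT p.2 = -p.2 ∧ p.2 0 0 + p.2 1 1 + p.2 2 2 = 0) ∧
      ∀ X : H3, (Δ X).mat = octEntrywise p.1 X.mat + (mmul p.2 X.mat - mmul X.mat p.2) := by
  obtain ⟨D, A, hDA, h⟩ := H3.IsDerivation.exists_decomposition hder
  refine ⟨(D, A), ⟨hDA, h⟩, fun ⟨D', A'⟩ ⟨hDA', h'⟩ => ?_⟩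
  obtain ⟨hD, hA⟩ := decomposition_unique (oder_oone hDA'.1) (oder_oone hDA.1) hDA'.2.2 hDA.2.2 h' h
  exact Prod.ext hD hA
end
end
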